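/- Unbiasedness of the ICVR estimator (Proposition 2): Let N ≥ 1 and for each i ∈ {1,…,N} let γ_i ∈ (0,1] be the conversion rate, θ_i ∈ [0,1] the propensity score, and δ1_i, δ0_i ∈ ℝ loss values. If Y_obs_1, …, Y_obs_N are {0,1}-valued random variables on a probability space (Ω, μ) with μ(Y_obs_i = 1) = θ_i·γ_i for every i, then the expectation of the ICVR estimator (1/N)·Σ_{i=1}^N [(Y_obs_i/γ_i)·δ1_i + (1 − Y_obs_i/γ_i)·δ0_i] equals the ideal loss for propensity estimation (1/N)·Σ_{i=1}^N [θ_i·δ1_i + (1 − θ_i)·δ0_i]. -/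

import Mathlib

open MeasureTheory Finset

/-- A `{0,1}`-valued function is the indicator of the event that it equals `1`. -/
lemma eq_indicator_of_zero_or_one {Ω : Type*} {Y : Ω → ℝ} (h01 : ∀ ω, Y ω = 0 ∨ Y ω = 1) :
    Y = {ω | Y ω = 1}.indicator 1 := by
  ext ω
  rcases h01 ω with h | h <;> simp [Set.indicator, h]

lemma integrable_of_zero_or_one {Ω : Type*} [MeasurableSpace Ω] {μ : Measure Ω}
    [IsFiniteMeasure μ] {Y : Ω → ℝ} (hY : Measurable Y) (h01 : ∀ ω, Y ω = 0 ∨ Y ω = 1) :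
    Integrable Y μ := by
  refine Integrable.of_bound hY.aestronglyMeasurable 1 (ae_of_all _ fun ω => ?_)
  rcases h01 ω with h | h <;> simp [h]

/-- The expectation of a `{0,1}`-valued function is the probability that it equals `1`. -/
lemma integral_of_zero_or_one {Ω : Type*} [MeasurableSpace Ω] {μ : Measure Ω}
    {Y : Ω → ℝ} (hY : Measurable Y) (h01 : ∀ ω, Y ω = 0 ∨ Y ω = 1) :
    ∫ ω, Y ω ∂μ = μ.real {ω | Y ω = 1} := by
  conv_lhs => rw [eq_indicator_of_zero_or_one h01]
  exact integral_indicator_one (hY (measurableSet_singleton 1))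

/-- **Unbiasedness of the ICVR estimator (Proposition 2).**
For `N ≥ 1` samples with conversion rates `γ i ∈ (0,1]`, propensity scores `θ i ∈ [0,1]`,
loss values `δ1 i, δ0 i`, and `{0,1}`-valued observed conversion indicators `Yobs i`
with `μ(Yobs i = 1) = θ i * γ i`, the expectation of the ICVR estimator
`(1/N) * ∑ i, (Yobs i / γ i) * δ1 i + (1 - Yobs i / γ i) * δ0 i` equals the
ideal loss for propensity estimation `(1/N) * ∑ i, θ i * δ1 i + (1 - θ i) * δ0 i`. -/
theorem icvr_estimator_unbiased
    {Ω : Type*} [MeasurableSpace Ω] (μ : Measure Ω) [IsProbabilityMeasure μ]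
    (N : ℕ) (hN : 1 ≤ N)
    (θ γ δ1 δ0 : Fin N → ℝ)
    (hγ : ∀ i, γ i ∈ Set.Ioc (0 : ℝ) 1) (hθ : ∀ i, θ i ∈ Set.Icc (0 : ℝ) 1)
    (Yobs : Fin N → Ω → ℝ) (hYmeas : ∀ i, Measurable (Yobs i))
    (hY01 : ∀ i ω, Yobs i ω = 0 ∨ Yobs i ω = 1)
    (hp : ∀ i, μ {ω | Yobs i ω = 1} = ENNReal.ofReal (θ i * γ i)) :
    ∫ ω, ((1 : ℝ) / N) * ∑ i, ((Yobs i ω / γ i) * δ1 i + (1 - Yobs i ω / γ i) * δ0 i) ∂μ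
      = ((1 : ℝ) / N) * ∑ i, (θ i * δ1 i + (1 - θ i) * δ0 i) := by
  have hint i : Integrable (Yobs i) μ := integrable_of_zero_or_one (hYmeas i) (hY01 i)
  have hexp i : ∫ ω, Yobs i ω ∂μ = θ i * γ i := by
    rw [integral_of_zero_or_one (hYmeas i) (hY01 i), measureReal_def, hp i,
      ENNReal.toReal_ofReal (mul_nonneg (hθ i).1 (hγ i).1.le)]
  have hint₁ i : Integrable (fun ω => Yobs i ω / γ i * δ1 i) μ :=
    ((hint i).div_const _).mul_const _
  have hint₀ i : Integrable (fun ω => (1 - Yobs i ω / γ i) * δ0 i) μ :=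
    ((integrable_const 1).sub ((hint i).div_const _)).mul_const _
  rw [integral_const_mul, integral_finsetSum _ fun i _ => by
    exact (hint₁ i).add (hint₀ i)]
  congr 1
  refine Finset.sum_congr rfl fun i _ => ?_
  have hγi : γ i ≠ 0 := (hγ i).1.ne'
  rw [integral_add (hint₁ i) (hint₀ i), integral_mul_const, integral_mul_const,
    integral_sub (integrable_const 1) ((hint i).div_const _), integral_div, hexp i,
    mul_div_cancel_right₀ _ hγi]
  simp
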